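/- Let M be a compact metric space, and let x, y : ℝ → M be continuous curves with x(0) = y(0). Suppose that for every time horizon T ≥ 0 and every Borel set B ⊆ M, the occupation times agree: ∫_0^T 1_B(x(s)) ds = ∫_0^T 1_B(y(s)) ds (integrals with respect to Lebesgue measure on ℝ, 1_B the indicator function of B). Then x(T) = y(T) for all T ≥ 0, i.e. the two trajectories are identical on [0, ∞). -/

import Mathlib

open MeasureTheory

/-- Lemma 4: equality of occupation measures for all time horizons forces
equality of the trajectories. -/
theorem occupation_measures_determine_trajectory
    {M : Type*} [MetricSpace M] [CompactSpace M] [MeasurableSpace M] [BorelSpace M]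
    (x y : ℝ → M) (hx : Continuous x) (hy : Continuous y) (h0 : x 0 = y 0)
    (hocc : ∀ T : ℝ, 0 ≤ T → ∀ B : Set M, MeasurableSet B →
      (∫ s in (0:ℝ)..T, B.indicator (fun _ => (1:ℝ)) (x s)) =
      (∫ s in (0:ℝ)..T, B.indicator (fun _ => (1:ℝ)) (y s))) :
    ∀ T : ℝ, 0 ≤ T → x T = y T := by
  intro T hT
  by_contra hne
  have hd : 0 < dist (x T) (y T) := dist_pos.mpr hne
  set r := dist (x T) (y T) / 2 with hr
  have hrpos : 0 < r := by positivity
  set B : Set M := Metric.ball (x T) r with hB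
  have hBm : MeasurableSet B := measurableSet_ball
  have e1 : ∀ᶠ s in nhds T, dist (x s) (x T) < r :=
    hx.continuousAt.eventually (Metric.ball_mem_nhds (x T) hrpos)
  have e2 : ∀ᶠ s in nhds T, dist (y s) (y T) < r :=
    hy.continuousAt.eventually (Metric.ball_mem_nhds (y T) hrpos)
  obtain ⟨ε, hε, hball⟩ := Metric.eventually_nhds_iff.mp (e1.and e2)
  have hint : ∀ z : ℝ → M, Continuous z → ∀ a b : ℝ,
      IntervalIntegrable (fun s => B.indicator (fun _ => (1:ℝ)) (z s)) volume a b := by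
    intro z hz a b
    have hm : Measurable (fun s => B.indicator (fun _ => (1:ℝ)) (z s)) :=
      (measurable_const.indicator hBm).comp hz.measurable
    refine (intervalIntegrable_const (c := (1:ℝ))).mono_fun hm.aestronglyMeasurable ?_
    refine Filter.Eventually.of_forall fun s => ?_
    by_cases h : z s ∈ B <;> simp [h]
  have key : (∫ s in T..(T + ε / 2), B.indicator (fun _ => (1:ℝ)) (x s)) =
      ∫ s in T..(T + ε / 2), B.indicator (fun _ => (1:ℝ)) (y s) := by
    rw [← intervalIntegral.integral_interval_sub_left (hint x hx 0 _) (hint x hx 0 T),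
      ← intervalIntegral.integral_interval_sub_left (hint y hy 0 _) (hint y hy 0 T),
      hocc T hT B hBm, hocc (T + ε / 2) (by linarith) B hBm]
  have near : ∀ s ∈ Set.uIcc T (T + ε / 2), dist s T < ε := by
    intro s hs
    rw [Set.uIcc_of_le (by linarith)] at hs
    rw [Real.dist_eq, abs_of_nonneg (by linarith [hs.1])]
    linarith [hs.2]
  have k1 : (∫ s in T..(T + ε / 2), B.indicator (fun _ => (1:ℝ)) (x s)) =
      ∫ _s in T..(T + ε / 2), (1:ℝ) := by
    refine intervalIntegral.integral_congr fun s hs => ?_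
    exact Set.indicator_of_mem (s := B) (hball (near s hs)).1 _
  have k2 : (∫ s in T..(T + ε / 2), B.indicator (fun _ => (1:ℝ)) (y s)) =
      ∫ _s in T..(T + ε / 2), (0:ℝ) := by
    refine intervalIntegral.integral_congr fun s hs => ?_
    refine Set.indicator_of_notMem (s := B) (fun hmem => ?_) _
    have h1 : dist (y s) (x T) < r := hmem
    have h2 := (hball (near s hs)).2
    have h3 := dist_triangle_left (x T) (y T) (y s)
    linarith
  rw [k1, k2] at key
  simp at key
  linarith
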